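/- For every integer k ≥ 2, every graph G on n vertices with average degree d ≥ 2·10⁵·k³·n^{1/k} contains at least (1/2)·(2¹²·k)^{−k}·d^{2k} copies of the cycle of length 2k. -/

import Mathlib

/-! ### Log-convex sequences -/

namespace EvenCycles

theorem lc_pos (f : ℕ → ℝ) (h0 : 0 < f 0) (h1 : 0 < f 1) (hn : ∀ m, 0 ≤ f m)
    (h : ∀ m, f (m + 1) ^ 2 ≤ f m * f (m + 2)) (m : ℕ) : 0 < f m ∧ 0 < f (m + 1) := by
  induction m with
  | zero => exact ⟨h0, h1⟩
  | succ m ih =>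
    refine ⟨ih.2, ?_⟩
    rcases (hn (m + 1 + 1)).lt_or_eq with h2 | h2
    · exact h2
    · have h3 := h m
      have h4 : 0 < f (m + 1) ^ 2 := pow_pos ih.2 2
      have h5 : f (m + 2) = 0 := h2.symm
      rw [h5, mul_zero] at h3
      linarith

theorem lc_step (f : ℕ → ℝ) (hp : ∀ m, 0 < f m)
    (h : ∀ m, f (m + 1) ^ 2 ≤ f m * f (m + 2)) (a p : ℕ) :
    f (a + 1) * f (a + p) ≤ f a * f (a + p + 1) := by
  induction p with
  | zero => simp [mul_comm]
  | succ p ih =>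
    have h1 := h (a + p)
    have e : a + (p + 1) = a + p + 1 := by ring
    rw [e]
    have hb := hp (a + p)
    have hb1 := hp (a + p + 1)
    have key : f (a + 1) * f (a + p + 1) * (f (a + p) * f (a + p + 1)) ≤
        f a * f (a + p + 2) * (f (a + p) * f (a + p + 1)) := by
      calc f (a + 1) * f (a + p + 1) * (f (a + p) * f (a + p + 1))
          = (f (a + 1) * f (a + p)) * f (a + p + 1) ^ 2 := by ring
        _ ≤ (f a * f (a + p + 1)) * (f (a + p) * f (a + p + 2)) := by
            apply mul_le_mul ih h1 (by positivity)
            exact mul_nonneg (hp a).le hb1.le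
        _ = _ := by ring
    exact le_of_mul_le_mul_right key (mul_pos hb hb1)

theorem lc_mid (f : ℕ → ℝ) (hp : ∀ m, 0 < f m)
    (h : ∀ m, f (m + 1) ^ 2 ≤ f m * f (m + 2)) (i p : ℕ) :
    f (i + 1) * f (i + 1 + p) ≤ f 1 * f (1 + (2 * i + p)) := by
  induction i generalizing p with
  | zero => simp
  | succ i ih =>
    have h1 := lc_step f hp h (i + 1) (p + 1)
    have h2 := ih (p + 2)
    have e1 : i + 1 + (p + 1) = i + 1 + 1 + p := by ring
    have e2 : i + 1 + (p + 2) = i + 1 + 1 + p + 1 := by ring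
    have e3 : 1 + (2 * i + (p + 2)) = 1 + (2 * (i + 1) + p) := by ring
    rw [e1] at h1
    rw [e2, e3] at h2
    exact h1.trans h2

/-- symmetric form -/
theorem lc_mid' (f : ℕ → ℝ) (hp : ∀ m, 0 < f m)
    (h : ∀ m, f (m + 1) ^ 2 ≤ f m * f (m + 2)) (k i : ℕ) (hi : 1 ≤ i) (hik : i + 1 ≤ k) :
    f i * f (k - i) ≤ f 1 * f (k - 1) := by
  rcases le_total i (k - i) with h1 | h1
  · obtain ⟨a, rfl⟩ : ∃ a, i = a + 1 := ⟨i - 1, by omega⟩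
    have := lc_mid f hp h a (k - (a + 1) - (a + 1))
    rwa [show a + 1 + (k - (a + 1) - (a + 1)) = k - (a + 1) by omega,
      show 1 + (2 * a + (k - (a + 1) - (a + 1))) = k - 1 by omega] at this
  · obtain ⟨a, ha⟩ : ∃ a, k - i = a + 1 := ⟨k - i - 1, by omega⟩
    have := lc_mid f hp h a (i - (a + 1))
    rw [show a + 1 + (i - (a + 1)) = i by omega,
      show 1 + (2 * a + (i - (a + 1))) = k - 1 by omega] at this
    rw [ha, mul_comm]
    exact this

theorem lc_power (f : ℕ → ℝ) (hp : ∀ m, 0 < f m)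
    (h : ∀ m, f (m + 1) ^ 2 ≤ f m * f (m + 2)) (m : ℕ) :
    f m ^ (m + 1) ≤ f 0 * f (m + 1) ^ m := by
  induction m with
  | zero => simp
  | succ m ih =>
    have h1 : (f (m + 1) ^ 2) ^ (m + 1) ≤ (f m * f (m + 2)) ^ (m + 1) :=
      pow_le_pow_left₀ (by positivity) (h m) _
    have a := hp (m + 1)
    have b := hp (m + 2)
    have key : f (m + 1) ^ (m + 1 + 1) * f (m + 1) ^ m ≤
        (f 0 * f (m + 1 + 1) ^ (m + 1)) * f (m + 1) ^ m := by
      calc f (m + 1) ^ (m + 1 + 1) * f (m + 1) ^ m = (f (m + 1) ^ 2) ^ (m + 1) := by ring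
        _ ≤ (f m * f (m + 2)) ^ (m + 1) := h1
        _ = f m ^ (m + 1) * f (m + 2) ^ (m + 1) := by ring
        _ ≤ (f 0 * f (m + 1) ^ m) * f (m + 2) ^ (m + 1) := by gcongr
        _ = _ := by ring
    exact le_of_mul_le_mul_right key (by positivity)

/-! ### Matrix products as sums over closed tuples -/

section Paths

variable {V : Type*} [Fintype V] [DecidableEq V]

/-- Partial products of a sequence of matrices. -/
noncomputable def partialProd (M : ℕ → Matrix V V ℝ) : ℕ → Matrix V V ℝ
  | 0 => 1
  | n + 1 => partialProd M n * M n

theorem path_sum (M : ℕ → Matrix V V ℝ) (n : ℕ) (Φ : V → V → ℝ) :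
    ∑ f : Fin (n + 1) → V, Φ (f 0) (f (Fin.last n)) *
      ∏ i : Fin n, M i (f i.castSucc) (f i.succ) = ∑ x, ∑ y, Φ x y * partialProd M n x y := by
  induction n generalizing Φ with
  | zero =>
    rw [← (Equiv.funUnique (Fin 1) V).symm.sum_comp]
    simp [partialProd, Matrix.one_apply]
  | succ n ih =>
    rw [← (Fin.snocEquiv (fun _ => V)).sum_comp, Fintype.sum_prod_type_right]
    have h1 : ∀ (f : Fin (n + 1) → V),
        ∑ z : V, (Φ ((Fin.snocEquiv (fun _ => V)) (z, f) 0)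
            ((Fin.snocEquiv (fun _ => V)) (z, f) (Fin.last (n + 1))) *
          ∏ i : Fin (n + 1), M i ((Fin.snocEquiv (fun _ => V)) (z, f) i.castSucc)
            ((Fin.snocEquiv (fun _ => V)) (z, f) i.succ)) =
        (fun x y => ∑ z, Φ x z * M n y z) (f 0) (f (Fin.last n)) *
          ∏ i : Fin n, M i (f i.castSucc) (f i.succ) := by
      intro f
      rw [Finset.sum_mul]
      refine Finset.sum_congr rfl fun z _ => ?_
      rw [Fin.prod_univ_castSucc]
      simp only [Fin.snocEquiv, Equiv.coe_fn_mk, Fin.snoc_last, Fin.snoc_castSucc,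
        Fin.succ_last, Fin.val_castSucc, Fin.val_last, ← Fin.castSucc_succ, Fin.snoc_apply_zero]
      ring
    refine (Finset.sum_congr rfl fun f _ => h1 f).trans
      ((ih (fun x y => ∑ z, Φ x z * M n y z)).trans ?_)
    refine Finset.sum_congr rfl fun x _ => ?_
    simp only [partialProd, Matrix.mul_apply, Finset.sum_mul, Finset.mul_sum]
    rw [Finset.sum_comm]
    refine Finset.sum_congr rfl fun z _ => Finset.sum_congr rfl fun y _ => ?_
    ring

theorem closed_sum (M : ℕ → Matrix V V ℝ) (n : ℕ) :
    ∑ f : Fin (n + 1) → V, ∏ i : Fin (n + 1), M i (f i) (f (i + 1)) =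
      (partialProd M (n + 1)).trace := by
  have := path_sum M n (fun x y => M n y x)
  rw [Matrix.trace]
  simp only [partialProd, Matrix.diag_apply, Matrix.mul_apply]
  calc _ = _ := ?_
    _ = _ := this
    _ = _ := Finset.sum_congr rfl fun x _ => Finset.sum_congr rfl fun y _ => mul_comm _ _
  refine Finset.sum_congr rfl fun f _ => ?_
  rw [Fin.prod_univ_castSucc, mul_comm]
  simp

theorem closed_sum_pow (S : Matrix V V ℝ) (n : ℕ) :
    ∑ f : Fin (n + 1) → V, ∏ i : Fin (n + 1), S (f i) (f (i + 1)) = (S ^ (n + 1)).trace := by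
  have h : ∀ m, partialProd (fun _ => S) m = S ^ m := by
    intro m
    induction m with
    | zero => rfl
    | succ m ih => rw [partialProd, ih, pow_succ]
  rw [← h, ← closed_sum]

theorem closed_sum_pin (S : Matrix V V ℝ) (n i j : ℕ) (hij : i < j) (hj : j < n + 1) (x : V) :
    ∑ f : Fin (n + 1) → V, (if f ⟨i, hij.trans hj⟩ = x ∧ f ⟨j, hj⟩ = x then
      ∏ i : Fin (n + 1), S (f i) (f (i + 1)) else 0) =
      (S ^ (j - i)) x x * (S ^ (n + 1 - (j - i))) x x := by
  classical
  set E : Matrix V V ℝ := Matrix.single x x 1 with hE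
  set M : ℕ → Matrix V V ℝ := fun m => if m = i ∨ m = j then E * S else S with hM
  have hES : ∀ y z, (E * S) y z = if y = x then S y z else 0 := by
    intro y z
    by_cases h : y = x
    · subst h; simp [hE]
    · simp [hE, h]
  have h1 : ∀ m, m ≤ i → partialProd M m = S ^ m := by
    intro m
    induction m with
    | zero => intro _; rfl
    | succ m ih =>
      intro hm
      have : M m = S := by simp only [hM]; rw [if_neg (by omega)]
      rw [partialProd, ih (by omega), this, pow_succ]
  have h2 : ∀ p, i + (p + 1) ≤ j → partialProd M (i + (p + 1)) = S ^ i * E * S ^ (p + 1) := by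
    intro p
    induction p with
    | zero =>
      intro hp
      have : M i = E * S := by simp [hM]
      change partialProd M i * M i = _
      rw [h1 i le_rfl, this]; simp [Matrix.mul_assoc]
    | succ p ih =>
      intro hp
      have : M (i + (p + 1)) = S := by simp only [hM]; rw [if_neg (by omega)]
      change partialProd M (i + (p + 1)) * M (i + (p + 1)) = _
      rw [ih (by omega), this, pow_succ S (p + 1), Matrix.mul_assoc (S ^ i * E)]
  have h3 : ∀ p, partialProd M (j + (p + 1)) =
      S ^ i * E * S ^ (j - i) * E * S ^ (p + 1) := by
    intro p
    induction p with
    | zero =>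
      have : M j = E * S := by simp [hM]
      change partialProd M j * M j = _
      have := h2 (j - i - 1) (by omega)
      rw [show i + (j - i - 1 + 1) = j by omega, show j - i - 1 + 1 = j - i by omega] at this
      rw [this, ‹M j = E * S›]; simp [Matrix.mul_assoc]
    | succ p ih =>
      have : M (j + (p + 1)) = S := by simp only [hM]; rw [if_neg (by omega)]
      change partialProd M (j + (p + 1)) * M (j + (p + 1)) = _
      rw [ih, this, pow_succ S (p + 1), ← Matrix.mul_assoc]
  have h4 := closed_sum M n
  have e : n + 1 = j + ((n - j) + 1) := by omega
  have h5 : (partialProd M (n + 1)).trace =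
      (S ^ (j - i)) x x * (S ^ (n + 1 - (j - i))) x x := by
    rw [e, h3, ← e, Matrix.trace_mul_comm]
    have : S ^ (n - j + 1) * (S ^ i * E * S ^ (j - i) * E) =
        S ^ (n + 1 - (j - i)) * (E * S ^ (j - i) * E) := by
      rw [show n + 1 - (j - i) = (n - j + 1) + i by omega, pow_add S (n - j + 1) i]
      simp only [Matrix.mul_assoc]
    rw [this]
    have hEE : E * S ^ (j - i) * E = Matrix.single x x ((S ^ (j - i)) x x) := by
      rw [hE]; simp
    rw [hEE, Matrix.trace_mul_single]
    simp [mul_comm]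
  rw [← h5, ← h4]
  refine Finset.sum_congr rfl fun f _ => ?_
  by_cases hc : f ⟨i, hij.trans hj⟩ = x ∧ f ⟨j, hj⟩ = x
  · rw [if_pos hc]
    refine Finset.prod_congr rfl fun m _ => ?_
    simp only [hM]
    split_ifs with hm
    · rw [hES, if_pos]
      rcases hm with hm | hm
      · rw [← hc.1]; congr 1; exact Fin.ext hm
      · rw [← hc.2]; congr 1; exact Fin.ext hm
    · rfl
  · rw [if_neg hc]
    symm
    rw [not_and_or] at hc
    rcases hc with hc | hc
    · refine Finset.prod_eq_zero (Finset.mem_univ ⟨i, hij.trans hj⟩) ?_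
      simp only [hM, true_or, if_true]
      rw [hES, if_neg hc]
    · refine Finset.prod_eq_zero (Finset.mem_univ ⟨j, hj⟩) ?_
      simp only [hM, or_true, if_true]
      rw [hES, if_neg hc]

theorem closed_sum_eq (S : Matrix V V ℝ) (n : ℕ) (i j : Fin (n + 1)) (hij : i < j) :
    ∑ f : Fin (n + 1) → V, (if f i = f j then
      ∏ i : Fin (n + 1), S (f i) (f (i + 1)) else 0) =
      ∑ x, (S ^ (j.1 - i.1)) x x * (S ^ (n + 1 - (j.1 - i.1))) x x := by
  rw [Finset.sum_congr rfl fun x _ => (closed_sum_pin S n i.1 j.1 hij j.2 x).symm,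
    Finset.sum_comm]
  refine Finset.sum_congr rfl fun f _ => ?_
  by_cases h : f i = f j
  · rw [if_pos h, Finset.sum_eq_single (f i)]
    · simp [h]
    · intro b _ hb
      rw [if_neg]
      intro hc
      exact hb hc.1.symm
    · simp
  · rw [if_neg h]
    symm
    refine Finset.sum_eq_zero fun x _ => ?_
    rw [if_neg]
    intro hc
    exact h (hc.1.trans hc.2.symm)

end Paths

section Symm

variable {V : Type*} [Fintype V] [DecidableEq V]

theorem pow_symm (S : Matrix V V ℝ) (hS : S.IsSymm) (m : ℕ) (x y : V) :
    (S ^ m) x y = (S ^ m) y x := by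
  have h : (S ^ m).IsSymm := hS.pow m
  exact (h.apply x y).symm

theorem pow_diag (S : Matrix V V ℝ) (hS : S.IsSymm) (i j : ℕ) (x : V) :
    (S ^ (i + j)) x x = ∑ y, (S ^ i) x y * (S ^ j) x y := by
  rw [pow_add, Matrix.mul_apply]
  refine Finset.sum_congr rfl fun y _ => ?_
  rw [pow_symm S hS j y x]

theorem pow_diag_two (S : Matrix V V ℝ) (hS : S.IsSymm) (i : ℕ) (x : V) :
    (S ^ (2 * i)) x x = ∑ y, (S ^ i) x y ^ 2 := by
  rw [two_mul, pow_diag S hS]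
  simp only [sq]

theorem diag_nonneg (S : Matrix V V ℝ) (hS : S.IsSymm) (i : ℕ) (x : V) :
    0 ≤ (S ^ (2 * i)) x x := by
  rw [pow_diag_two S hS]
  positivity

theorem diag_cs (S : Matrix V V ℝ) (hS : S.IsSymm) (i j : ℕ) (x : V) :
    (S ^ (i + j)) x x ^ 2 ≤ (S ^ (2 * i)) x x * (S ^ (2 * j)) x x := by
  rw [pow_diag S hS, pow_diag_two S hS, pow_diag_two S hS]
  exact Finset.sum_mul_sq_le_sq_mul_sq _ _ _

theorem trace_eq (S : Matrix V V ℝ) (hS : S.IsSymm) (i : ℕ) :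
    (S ^ (2 * i)).trace = ∑ p : V × V, (S ^ i) p.1 p.2 ^ 2 := by
  rw [Fintype.sum_prod_type]
  refine Finset.sum_congr rfl fun x _ => ?_
  exact pow_diag_two S hS i x

theorem trace_cs (S : Matrix V V ℝ) (hS : S.IsSymm) (i j : ℕ) :
    (S ^ (i + j)).trace ^ 2 ≤ (S ^ (2 * i)).trace * (S ^ (2 * j)).trace := by
  have : (S ^ (i + j)).trace = ∑ p : V × V, (S ^ i) p.1 p.2 * (S ^ j) p.1 p.2 := by
    rw [Fintype.sum_prod_type]
    exact Finset.sum_congr rfl fun x _ => pow_diag S hS i j x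
  rw [this, trace_eq S hS, trace_eq S hS]
  exact Finset.sum_mul_sq_le_sq_mul_sq _ _ _

/-- A nonzero fixed vector forces the trace of even powers to be at least one. -/
theorem one_le_trace (S : Matrix V V ℝ) (hS : S.IsSymm) (v : V → ℝ) (hv : S.mulVec v = v)
    (hv0 : 0 < ∑ x, v x ^ 2) (k : ℕ) : 1 ≤ (S ^ (2 * k)).trace := by
  have hk : (S ^ k).mulVec v = v := by
    induction k with
    | zero => simp
    | succ k ih => rw [pow_succ, ← Matrix.mulVec_mulVec, hv, ih]
  have h1 : ∑ p : V × V, (S ^ k) p.1 p.2 * (v p.1 * v p.2) = ∑ x, v x ^ 2 := by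
    rw [Fintype.sum_prod_type]
    refine Finset.sum_congr rfl fun x _ => ?_
    have := congrFun hk x
    simp only [Matrix.mulVec, dotProduct] at this
    calc ∑ y, (S ^ k) x y * (v x * v y) = v x * ∑ y, (S ^ k) x y * v y := by
          rw [Finset.mul_sum]
          exact Finset.sum_congr rfl fun y _ => by ring
      _ = _ := by rw [this]; ring
  have h2 : ∑ p : V × V, (v p.1 * v p.2) ^ 2 = (∑ x, v x ^ 2) ^ 2 := by
    rw [Fintype.sum_prod_type, sq, Finset.sum_mul_sum]
    exact Finset.sum_congr rfl fun x _ => Finset.sum_congr rfl fun y _ => by ring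
  have h3 := Finset.sum_mul_sq_le_sq_mul_sq (Finset.univ : Finset (V × V))
    (fun p => (S ^ k) p.1 p.2) (fun p => v p.1 * v p.2)
  rw [h1, h2, ← trace_eq S hS] at h3
  have h4 : 0 < (∑ x, v x ^ 2) ^ 2 := by positivity
  nlinarith

/-- The diagonal products are maximised at the ends. -/
theorem diag_prod_le (S : Matrix V V ℝ) (hS : S.IsSymm) (x : V) (h0 : S x x = 0)
    (h2 : 0 < (S ^ 2) x x) (k j : ℕ) (hk : 2 ≤ k) (hj : 1 ≤ j) (hjk : j + 1 ≤ 2 * k) :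
    (S ^ j) x x * (S ^ (2 * k - j)) x x ≤ (S ^ 2) x x * (S ^ (2 * k - 2)) x x := by
  set f : ℕ → ℝ := fun m => (S ^ (2 * m)) x x with hf
  have hn : ∀ m, 0 ≤ f m := fun m => diag_nonneg S hS m x
  have hlc : ∀ m, f (m + 1) ^ 2 ≤ f m * f (m + 2) := by
    intro m
    have := diag_cs S hS m (m + 2) x
    rwa [show m + (m + 2) = 2 * (m + 1) by ring] at this
  have hp : ∀ m, 0 < f m := fun m => (lc_pos f (by simp [hf]) (by simpa [hf] using h2) hn hlc m).1
  have hR : (S ^ 2) x x * (S ^ (2 * k - 2)) x x = f 1 * f (k - 1) := by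
    simp only [hf]
    rw [show 2 * k - 2 = 2 * (k - 1) by omega]
  rw [hR]
  have hR0 : 0 ≤ f 1 * f (k - 1) := mul_nonneg (hn _) (hn _)
  rcases Nat.even_or_odd' j with ⟨i, hi | hi⟩
  · have := lc_mid' f hp hlc k i (by omega) (by omega)
    simp only [hf] at this ⊢
    rw [hi, show 2 * k - 2 * i = 2 * (k - i) by omega]
    exact this
  · by_cases hi0 : i = 0
    · subst hi0
      rw [hi]
      simpa [h0] using hR0
    by_cases hik : i + 1 = k
    · rw [show 2 * k - j = 1 by omega]
      simpa [h0] using hR0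
    have c1 := diag_cs S hS i (i + 1) x
    have c2 := diag_cs S hS (k - i) (k - (i + 1)) x
    rw [show i + (i + 1) = j by omega] at c1
    rw [show k - i + (k - (i + 1)) = 2 * k - j by omega] at c2
    have m1 := lc_mid' f hp hlc k i (by omega) (by omega)
    have m2 := lc_mid' f hp hlc k (i + 1) (by omega) (by omega)
    change _ ≤ f i * f (i + 1) at c1
    change _ ≤ f (k - i) * f (k - (i + 1)) at c2
    refine le_of_sq_le_sq ?_ hR0
    calc ((S ^ j) x x * (S ^ (2 * k - j)) x x) ^ 2
        = (S ^ j) x x ^ 2 * (S ^ (2 * k - j)) x x ^ 2 := by ring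
      _ ≤ (f i * f (i + 1)) * (f (k - i) * f (k - (i + 1))) :=
          mul_le_mul c1 c2 (sq_nonneg _) (mul_nonneg (hn _) (hn _))
      _ = (f i * f (k - i)) * (f (i + 1) * f (k - (i + 1))) := by ring
      _ ≤ (f 1 * f (k - 1)) * (f 1 * f (k - 1)) :=
          mul_le_mul m1 m2 (mul_nonneg (hn _) (hn _)) hR0
      _ = _ := by ring

theorem trace_le (S : Matrix V V ℝ) (hS : S.IsSymm) (h1 : ∀ m, 1 ≤ (S ^ (2 * m)).trace)
    (k : ℕ) (hk : 2 ≤ k) :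
    (S ^ (2 * k - 2)).trace ≤ (Fintype.card V : ℝ) ^ ((1 : ℝ) / k) * (S ^ (2 * k)).trace := by
  set f : ℕ → ℝ := fun m => (S ^ (2 * m)).trace with hf
  have hlc : ∀ m, f (m + 1) ^ 2 ≤ f m * f (m + 2) := by
    intro m
    have := trace_cs S hS m (m + 2)
    rwa [show m + (m + 2) = 2 * (m + 1) by ring] at this
  have hp : ∀ m, 0 < f m := fun m => lt_of_lt_of_le one_pos (h1 m)
  have h := lc_power f hp hlc (k - 1)
  rw [show k - 1 + 1 = k by omega] at h
  have hf0 : f 0 = Fintype.card V := by simp [hf]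
  have e : (S ^ (2 * k - 2)).trace = f (k - 1) := by
    simp only [hf]; rw [show 2 * k - 2 = 2 * (k - 1) by omega]
  rw [e]
  change f (k - 1) ≤ _ * f k
  have hk0 : k ≠ 0 := by omega
  refine le_of_pow_le_pow_left₀ hk0 (mul_nonneg (by positivity) (hp k).le) ?_
  rw [mul_pow, one_div, Real.rpow_inv_natCast_pow (by positivity) hk0, ← hf0]
  refine h.trans (mul_le_mul_of_nonneg_left ?_ (hp 0).le)
  exact pow_le_pow_right₀ (h1 k) (by omega)

end Symm

/-! ### Counting injective closed tuples in graphs of large minimum degree -/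

section Core

variable {V : Type*} [Fintype V] [DecidableEq V]

/-- The symmetrically normalised adjacency matrix. -/
noncomputable def normAdj (G : SimpleGraph V) [DecidableRel G.Adj] : Matrix V V ℝ :=
  fun x y => if G.Adj x y then (√(G.degree x : ℝ))⁻¹ * (√(G.degree y : ℝ))⁻¹ else 0

theorem core (G : SimpleGraph V) [DecidableRel G.Adj] [Nonempty V] (k m : ℕ) (hk : 2 ≤ k)
    (hm : 2 * k = m + 1) (δ : ℝ) (hδ0 : 0 < δ) (hdeg : ∀ v, δ ≤ G.degree v)
    (hδ : 8 * (k : ℝ) ^ 2 * (Fintype.card V : ℝ) ^ ((1 : ℝ) / k) ≤ δ) :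
    (1 / 2 : ℝ) * δ ^ (2 * k) ≤ (Nat.card {f : Fin (m + 1) → V //
      Function.Injective f ∧ ∀ i, G.Adj (f i) (f (i + 1))} : ℝ) := by
  classical
  set S := normAdj G with hSdef
  have hdpos : ∀ v, (0 : ℝ) < G.degree v := fun v => hδ0.trans_le (hdeg v)
  have hS : S.IsSymm := by
    ext x y
    simp only [Matrix.transpose_apply, hSdef, normAdj, G.adj_comm y x, mul_comm]
  have hS0 : ∀ x y, 0 ≤ S x y := by
    intro x y
    simp only [hSdef, normAdj]
    split_ifs <;> positivity
  have hsq : ∀ v, (√(G.degree v : ℝ))⁻¹ ≤ (√δ)⁻¹ := fun v => by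
    apply inv_anti₀ (Real.sqrt_pos.2 hδ0) (Real.sqrt_le_sqrt (hdeg v))
  have hSle : ∀ x y, S x y ≤ δ⁻¹ := by
    intro x y
    simp only [hSdef, normAdj]
    split_ifs
    · calc _ ≤ (√δ)⁻¹ * (√δ)⁻¹ := mul_le_mul (hsq x) (hsq y) (by positivity) (by positivity)
        _ = δ⁻¹ := by rw [← mul_inv, Real.mul_self_sqrt hδ0.le]
    · positivity
  have hSd : ∀ x, S x x = 0 := by
    intro x; simp [hSdef, normAdj]
  -- fixed vector
  set v : V → ℝ := fun x => √(G.degree x : ℝ) with hv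
  have hvpos : ∀ x, 0 < v x := fun x => Real.sqrt_pos.2 (hdpos x)
  have hfix : S.mulVec v = v := by
    ext x
    simp only [Matrix.mulVec, dotProduct]
    have h1 : ∀ y, S x y * v y = if G.Adj x y then (v x)⁻¹ else 0 := by
      intro y
      simp only [hSdef, normAdj]
      split_ifs
      · rw [mul_assoc, inv_mul_cancel₀ (hvpos y).ne', mul_one]
      · simp
    simp only [h1]
    rw [← Finset.sum_filter, Finset.sum_const, nsmul_eq_mul, ← G.neighborFinset_eq_filter,
      G.card_neighborFinset_eq_degree]
    have : (G.degree x : ℝ) = v x * v x := (Real.mul_self_sqrt (hdpos x).le).symm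
    rw [this, mul_assoc, mul_inv_cancel₀ (hvpos x).ne', mul_one]
  have hv0 : 0 < ∑ x, v x ^ 2 :=
    Finset.sum_pos (fun x _ => pow_pos (hvpos x) 2) Finset.univ_nonempty
  have hT1 := one_le_trace S hS v hfix hv0
  -- second diagonal moments
  have hS2 : ∀ x, (S ^ 2) x x = ∑ y, S x y ^ 2 := by
    intro x
    have := pow_diag_two S hS 1 x
    simpa using this
  have hS2le : ∀ x, (S ^ 2) x x ≤ δ⁻¹ := by
    intro x
    rw [hS2]
    calc ∑ y, S x y ^ 2 ≤ ∑ y, (if G.Adj x y then (G.degree x : ℝ)⁻¹ * δ⁻¹ else 0) := by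
          refine Finset.sum_le_sum fun y _ => ?_
          simp only [hSdef, normAdj]
          split_ifs
          · rw [mul_pow, inv_pow, inv_pow, Real.sq_sqrt (hdpos x).le, Real.sq_sqrt (hdpos y).le]
            exact mul_le_mul_of_nonneg_left (inv_anti₀ hδ0 (hdeg y))
              (inv_nonneg.2 (hdpos x).le)
          · simp
      _ = δ⁻¹ := by
          rw [← Finset.sum_filter, Finset.sum_const, nsmul_eq_mul, ← G.neighborFinset_eq_filter,
            G.card_neighborFinset_eq_degree, ← mul_assoc, mul_inv_cancel₀ (hdpos x).ne', one_mul]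
  have hS2pos : ∀ x, 0 < (S ^ 2) x x := by
    intro x
    rw [hS2]
    obtain ⟨y, hy⟩ : ∃ y, G.Adj x y := by
      have : 0 < G.degree x := by exact_mod_cast hdpos x
      exact (G.degree_pos_iff_exists_adj x).1 this
    refine Finset.sum_pos' (fun y _ => sq_nonneg _) ⟨y, Finset.mem_univ _, ?_⟩
    have : 0 < S x y := by
      simp only [hSdef, normAdj, if_pos hy]
      exact mul_pos (inv_pos.2 (hvpos x)) (inv_pos.2 (hvpos y))
    positivity
  set T := (S ^ (2 * k)).trace with hT
  set R := (S ^ (2 * k - 2)).trace with hR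
  have hRT : R ≤ (Fintype.card V : ℝ) ^ ((1 : ℝ) / k) * T := trace_le S hS hT1 k hk
  set N : (Fin (m + 1) → V) → ℝ := fun f => ∏ i, S (f i) (f (i + 1)) with hN
  have hN0 : ∀ f, 0 ≤ N f := fun f => Finset.prod_nonneg fun i _ => hS0 _ _
  have hNsum : ∑ f, N f = T := by rw [hT, hm]; exact closed_sum_pow S m
  have hdegen : ∀ i j : Fin (m + 1), i < j → ∑ f, (if f i = f j then N f else 0) ≤ δ⁻¹ * R := by
    intro i j hij
    have := closed_sum_eq S m i j hij
    rw [this, hR, Matrix.trace, Finset.mul_sum]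
    refine Finset.sum_le_sum fun x _ => ?_
    have hij' : i.1 < j.1 := hij
    have hj := j.2
    rw [show m + 1 - (j.1 - i.1) = 2 * k - (j.1 - i.1) by omega]
    refine (diag_prod_le S hS x (hSd x) (hS2pos x) k (j.1 - i.1) hk (by omega) (by omega)).trans ?_
    refine mul_le_mul_of_nonneg_right (hS2le x) ?_
    rw [show 2 * k - 2 = 2 * (k - 1) by omega]
    exact diag_nonneg S hS _ x
  set A : Finset (Fin (m + 1) → V) :=
    Finset.univ.filter fun f => Function.Injective f ∧ ∀ i, G.Adj (f i) (f (i + 1)) with hA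
  have hcard : (Nat.card {f : Fin (m + 1) → V //
      Function.Injective f ∧ ∀ i, G.Adj (f i) (f (i + 1))}) = A.card := by
    rw [Nat.card_eq_fintype_card, Fintype.card_subtype]
  rw [hcard]
  set I : Finset (Fin (m + 1) × Fin (m + 1)) := Finset.univ.filter fun p => p.1 < p.2 with hI
  have hpt : ∀ f, N f ≤ (if f ∈ A then N f else 0) +
      ∑ p ∈ I, (if f p.1 = f p.2 then N f else 0) := by
    intro f
    have hs0 : 0 ≤ ∑ p ∈ I, (if f p.1 = f p.2 then N f else 0) :=
      Finset.sum_nonneg fun p _ => by split_ifs; exacts [hN0 f, le_rfl]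
    by_cases hf : f ∈ A
    · rw [if_pos hf]; linarith
    rw [if_neg hf, zero_add]
    by_cases hinj : Function.Injective f
    · have : ∃ i, ¬ G.Adj (f i) (f (i + 1)) := by
        by_contra hcon
        push Not at hcon
        exact hf (by simp [hA, hinj, hcon])
      obtain ⟨i, hi⟩ := this
      have : N f = 0 := Finset.prod_eq_zero (Finset.mem_univ i) (by
        simp only [hSdef, normAdj, if_neg hi])
      rw [this] at hs0 ⊢
      exact hs0
    · obtain ⟨i, j, hij, hne⟩ : ∃ i j, f i = f j ∧ i < j := by
        simp only [Function.Injective] at hinj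
        push Not at hinj
        obtain ⟨i, j, h1, h2⟩ := hinj
        rcases lt_or_gt_of_ne h2 with h3 | h3
        · exact ⟨i, j, h1, h3⟩
        · exact ⟨j, i, h1.symm, h3⟩
      calc N f = (if f (i, j).1 = f (i, j).2 then N f else 0) := by rw [if_pos hij]
        _ ≤ _ := Finset.single_le_sum
            (f := fun p : Fin (m + 1) × Fin (m + 1) => if f p.1 = f p.2 then N f else 0)
            (fun p _ => by split_ifs; exacts [hN0 f, le_rfl]) (by simp [hI, hne])
  have hR0 : 0 ≤ R := by
    rw [hR, show 2 * k - 2 = 2 * (k - 1) by omega]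
    exact zero_le_one.trans (hT1 _)
  have hT1' : 1 ≤ T := hT1 k
  have hIcard : (I.card : ℝ) ≤ 4 * (k : ℝ) ^ 2 := by
    have h1 : I.card ≤ (2 * k) * (2 * k) := by
      refine (Finset.card_le_univ I).trans ?_
      simp [hm]
    calc (I.card : ℝ) ≤ (((2 * k) * (2 * k) : ℕ) : ℝ) := by exact_mod_cast h1
      _ = _ := by push_cast; ring
  have hNA : ∀ f, N f ≤ (δ⁻¹) ^ (2 * k) := by
    intro f
    calc N f ≤ ∏ i : Fin (m + 1), δ⁻¹ := Finset.prod_le_prod (fun i _ => hS0 _ _) fun i _ => hSle _ _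
      _ = _ := by simp [hm]
  have hmain : T ≤ A.card * (δ⁻¹) ^ (2 * k) + 4 * (k : ℝ) ^ 2 * (δ⁻¹ * R) := by
    calc T = ∑ f, N f := hNsum.symm
      _ ≤ ∑ f, ((if f ∈ A then N f else 0) + ∑ p ∈ I, (if f p.1 = f p.2 then N f else 0)) :=
          Finset.sum_le_sum fun f _ => hpt f
      _ = ∑ f ∈ A, N f + ∑ p ∈ I, ∑ f, (if f p.1 = f p.2 then N f else 0) := by
          rw [Finset.sum_add_distrib, Finset.sum_comm (s := Finset.univ) (t := I)]
          congr 1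
          simp
      _ ≤ ∑ f ∈ A, (δ⁻¹) ^ (2 * k) + ∑ p ∈ I, δ⁻¹ * R := by
          refine add_le_add (Finset.sum_le_sum fun f _ => hNA f) (Finset.sum_le_sum fun p hp => ?_)
          exact hdegen p.1 p.2 (by simpa [hI] using hp)
      _ = A.card * (δ⁻¹) ^ (2 * k) + I.card * (δ⁻¹ * R) := by simp
      _ ≤ _ := by
          gcongr
  have hhalf : 4 * (k : ℝ) ^ 2 * (δ⁻¹ * R) ≤ T / 2 := by
    calc 4 * (k : ℝ) ^ 2 * (δ⁻¹ * R)
        ≤ 4 * (k : ℝ) ^ 2 * (δ⁻¹ * ((Fintype.card V : ℝ) ^ ((1 : ℝ) / k) * T)) := by gcongr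
      _ = (8 * (k : ℝ) ^ 2 * (Fintype.card V : ℝ) ^ ((1 : ℝ) / k)) * δ⁻¹ * (T / 2) := by ring
      _ ≤ δ * δ⁻¹ * (T / 2) := by
          have : 0 ≤ T := by linarith
          gcongr
      _ = T / 2 := by rw [mul_inv_cancel₀ hδ0.ne', one_mul]
  have hfin : (1 / 2 : ℝ) ≤ A.card * (δ⁻¹) ^ (2 * k) := by linarith
  have hδp : 0 < δ ^ (2 * k) := pow_pos hδ0 _
  calc (1 / 2 : ℝ) * δ ^ (2 * k) ≤ (A.card * (δ⁻¹) ^ (2 * k)) * δ ^ (2 * k) := by gcongr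
    _ = A.card := by rw [inv_pow, mul_assoc, inv_mul_cancel₀ hδp.ne', mul_one]

end Core

/-! ### Subgraphs of large minimum degree -/

section MinDeg

variable {V : Type*} [DecidableEq V]

/-- Twice the number of edges inside `W`. -/
def degSum (G : SimpleGraph V) [DecidableRel G.Adj] (W : Finset V) : ℕ :=
  ∑ x ∈ W, ∑ y ∈ W, if G.Adj x y then 1 else 0

theorem degSum_insert (G : SimpleGraph V) [DecidableRel G.Adj] (W : Finset V) (v : V)
    (hv : v ∉ W) : degSum G (insert v W) =
      degSum G W + 2 * ∑ y ∈ W, if G.Adj v y then 1 else 0 := by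
  simp only [degSum, Finset.sum_insert hv, SimpleGraph.irrefl, if_false, zero_add,
    Finset.sum_add_distrib]
  have : ∑ x ∈ W, (if G.Adj x v then 1 else 0) = ∑ x ∈ W, if G.Adj v x then 1 else 0 :=
    Finset.sum_congr rfl fun x _ => by simp only [G.adj_comm]
  rw [this]
  ring

theorem exists_minDeg (G : SimpleGraph V) [DecidableRel G.Adj] (c : ℝ) (hc : 0 < c)
    (W : Finset V) (hW : W.Nonempty) (h : 2 * c * W.card ≤ degSum G W) :
    ∃ U : Finset V, U.Nonempty ∧ ∀ v ∈ U, c ≤ ((∑ y ∈ U, if G.Adj v y then 1 else 0 : ℕ) : ℝ) := by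
  induction W using Finset.strongInduction with
  | H W ih =>
    by_cases hall : ∀ v ∈ W, c ≤ ((∑ y ∈ W, if G.Adj v y then 1 else 0 : ℕ) : ℝ)
    · exact ⟨W, hW, hall⟩
    push Not at hall
    obtain ⟨v, hv, hlt⟩ := hall
    have hnot : v ∉ W.erase v := Finset.notMem_erase v W
    have hins := degSum_insert G (W.erase v) v hnot
    rw [Finset.insert_erase hv] at hins
    have hdv : ∑ y ∈ W, (if G.Adj v y then 1 else 0) =
        ∑ y ∈ W.erase v, if G.Adj v y then 1 else 0 := by
      rw [← Finset.add_sum_erase W _ hv]; simp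
    rw [hdv] at hlt
    have hcard : (W.card : ℝ) = (W.erase v).card + 1 := by
      rw [← Finset.card_erase_add_one hv]; push_cast; ring
    rw [hins, hcard, Nat.cast_add, Nat.cast_mul] at h
    refine ih (W.erase v) (Finset.erase_ssubset hv) ?_ ?_
    · by_contra hemp
      rw [Finset.not_nonempty_iff_eq_empty] at hemp
      rw [hemp] at h
      simp [degSum] at h
      linarith
    · push_cast at h hlt ⊢
      linarith

end MinDeg

/-! ### From injective closed tuples to subgraphs -/

section Copies

variable {V : Type*}

/-- The copy of the cycle given by an injective closed tuple. -/
def tupleCopy {m : ℕ} (G : SimpleGraph V) (f : {f : Fin (m + 2) → V //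
    Function.Injective f ∧ ∀ i, G.Adj (f i) (f (i + 1))}) :
    SimpleGraph.Copy (SimpleGraph.cycleGraph (m + 2)) G where
  toHom :=
    { toFun := f.1
      map_rel' := by
        intro a b hab
        rw [SimpleGraph.cycleGraph_adj] at hab
        rcases hab with h | h
        · rw [sub_eq_iff_eq_add'] at h
          rw [h]
          exact (f.2.2 b).symm
        · rw [sub_eq_iff_eq_add'] at h
          rw [h]
          exact f.2.2 a }
  injective' := f.2.1

theorem tuple_ext {m : ℕ} (hm : 1 ≤ m) (G : SimpleGraph V) (f g : {f : Fin (m + 2) → V //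
    Function.Injective f ∧ ∀ i, G.Adj (f i) (f (i + 1))})
    (h : (tupleCopy G f).toSubgraph = (tupleCopy G g).toSubgraph)
    (h0 : f.1 0 = g.1 0) (h1 : f.1 1 = g.1 1) : f = g := by
  have key : ∀ i : Fin (m + 2), f.1 i = g.1 i ∧ f.1 (i + 1) = g.1 (i + 1) := by
    intro i
    induction i using Fin.induction with
    | zero => simpa using ⟨h0, h1⟩
    | succ i ih =>
      rw [← Fin.coeSucc_eq_succ]
      set j := i.castSucc
      refine ⟨ih.2, ?_⟩
      have hadj : (tupleCopy G g).toSubgraph.Adj (g.1 (j + 1)) (g.1 (j + 1 + 1)) := by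
        refine ⟨j + 1, j + 1 + 1, ?_, rfl, rfl⟩
        change (SimpleGraph.cycleGraph (m + 2)).Adj _ _
        rw [SimpleGraph.cycleGraph_adj]
        right
        simp
      rw [← h] at hadj
      obtain ⟨a, b, hab, ha, hb⟩ := hadj
      change (SimpleGraph.cycleGraph (m + 2)).Adj _ _ at hab
      change f.1 a = _ at ha
      change f.1 b = _ at hb
      have ha' : a = j + 1 := f.2.1 (ha.trans ih.2.symm)
      rw [SimpleGraph.cycleGraph_adj] at hab
      rcases hab with hab | hab
      · rw [sub_eq_iff_eq_add', ha'] at hab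
        have hb' : b = j := by
          have := hab
          rw [add_comm b 1, add_comm j 1] at this
          exact (add_left_cancel (a := (1 : Fin (m + 2))) (by simpa [add_comm] using this)).symm
        rw [hb', ih.1] at hb
        have h2 : j = j + 1 + 1 := g.2.1 hb
        have h2' : j + (1 + 1 : Fin (m + 2)) = j := (add_assoc j 1 1).symm.trans h2.symm
        have h3 : (1 + 1 : Fin (m + 2)) = 0 := add_eq_left.1 h2'
        have h4 := congrArg Fin.val h3
        rw [Fin.val_add, Fin.val_one, Nat.mod_eq_of_lt (by omega)] at h4
        simp at h4
      · rw [sub_eq_iff_eq_add', ha'] at hab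
        rw [← hb, hab]
  exact Subtype.ext (funext fun i => (key i).1)

theorem card_tuples_le {m : ℕ} (hm : 1 ≤ m) [Fintype V] (G : SimpleGraph V) :
    Nat.card {f : Fin (m + 2) → V // Function.Injective f ∧ ∀ i, G.Adj (f i) (f (i + 1))} ≤
      (m + 2) ^ 2 * Nat.card {H : G.Subgraph //
        Nonempty (H.coe ≃g SimpleGraph.cycleGraph (m + 2))} := by
  classical
  rw [Nat.card_eq_fintype_card, Nat.card_eq_fintype_card]
  set Φ : {f : Fin (m + 2) → V // Function.Injective f ∧ ∀ i, G.Adj (f i) (f (i + 1))} →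
      {H : G.Subgraph // Nonempty (H.coe ≃g SimpleGraph.cycleGraph (m + 2))} :=
    fun f => ⟨(tupleCopy G f).toSubgraph, ⟨(tupleCopy G f).isoToSubgraph.symm⟩⟩ with hΦ
  have h1 := Finset.card_le_mul_card_image (f := Φ) Finset.univ ((m + 2) ^ 2) (by
    intro H hH
    obtain ⟨f0, -, rfl⟩ := Finset.mem_image.1 hH
    set R : Finset V := Finset.univ.image f0.1 with hR
    have hRc : R.card ≤ m + 2 := by
      refine Finset.card_image_le.trans ?_
      simp
    have hmem : ∀ f, Φ f = Φ f0 → ∀ i, f.1 i ∈ R := by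
      intro f hf i
      have h2 : (tupleCopy G f).toSubgraph = (tupleCopy G f0).toSubgraph :=
        congrArg Subtype.val hf
      have h3 : f.1 i ∈ (tupleCopy G f).toSubgraph.verts := ⟨i, trivial, rfl⟩
      rw [h2] at h3
      obtain ⟨j, -, hj⟩ := h3
      exact Finset.mem_image.2 ⟨j, Finset.mem_univ _, hj⟩
    calc _ ≤ (R ×ˢ R).card := by
          refine Finset.card_le_card_of_injOn (fun f => (f.1 0, f.1 1)) ?_ ?_
          · intro f hf
            have hf' : Φ f = Φ f0 := by simpa using hf
            simp [hmem f hf']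
          · intro f hf g hg hfg
            have hf' : Φ f = Φ f0 := by simpa using hf
            have hg' : Φ g = Φ f0 := by simpa using hg
            have h4 := Prod.mk.inj hfg
            exact tuple_ext hm G f g (congrArg Subtype.val (hf'.trans hg'.symm)) h4.1 h4.2
      _ = R.card * R.card := Finset.card_product _ _
      _ ≤ (m + 2) * (m + 2) := Nat.mul_le_mul hRc hRc
      _ = _ := by ring)
  refine le_trans h1 (Nat.mul_le_mul_left _ ?_)
  exact Finset.card_le_univ _

end Copies

theorem tuples_lower {V : Type*} [Fintype V] (k m : ℕ) (hk : 2 ≤ k) (hm : 2 * k = m + 1)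
    (G : SimpleGraph V) (d : ℝ) (hd0 : 0 < d)
    (hd : d = 2 * (Nat.card G.edgeSet : ℝ) / (Fintype.card V : ℝ))
    (hdlarge : 16 * (k : ℝ) ^ 2 * (Fintype.card V : ℝ) ^ ((1 : ℝ) / k) ≤ d) :
    (1 / 2 : ℝ) * (d / 2) ^ (2 * k) ≤ (Nat.card {f : Fin (m + 1) → V //
      Function.Injective f ∧ ∀ i, G.Adj (f i) (f (i + 1))} : ℝ) := by
  classical
  have hn : (Fintype.card V : ℝ) ≠ 0 := by
    intro h
    rw [h, div_zero] at hd
    linarith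
  have hne : Nonempty V := by
    rw [← Fintype.card_pos_iff]
    exact Nat.pos_of_ne_zero (by exact_mod_cast hn)
  have hds : degSum G Finset.univ = 2 * Nat.card G.edgeSet := by
    rw [Nat.card_eq_fintype_card, ← SimpleGraph.edgeFinset_card,
      ← G.sum_degrees_eq_twice_card_edges]
    refine Finset.sum_congr rfl fun x _ => ?_
    rw [← G.card_neighborFinset_eq_degree, G.neighborFinset_eq_filter, Finset.card_filter]
  obtain ⟨U, hU, hmin⟩ := exists_minDeg G (d / 2) (by linarith) Finset.univ
    Finset.univ_nonempty (by
      rw [hds, Finset.card_univ, hd]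
      push_cast
      field_simp
      exact le_rfl)
  have : Nonempty {x // x ∈ U} := hU.to_subtype
  set G' : SimpleGraph {x // x ∈ U} := G.comap Subtype.val with hG'
  have hdeg : ∀ v, d / 2 ≤ G'.degree v := by
    intro v
    refine (hmin v.1 v.2).trans (le_of_eq ?_)
    congr 1
    rw [← G'.card_neighborFinset_eq_degree, G'.neighborFinset_eq_filter, Finset.card_filter,
      ← Finset.sum_coe_sort U]
    rfl
  have hcard : (Fintype.card {x // x ∈ U} : ℝ) ≤ Fintype.card V := by
    exact_mod_cast Fintype.card_subtype_le _
  have hlarge : 8 * (k : ℝ) ^ 2 * (Fintype.card {x // x ∈ U} : ℝ) ^ ((1 : ℝ) / k) ≤ d / 2 := by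
    have : (Fintype.card {x // x ∈ U} : ℝ) ^ ((1 : ℝ) / k) ≤
        (Fintype.card V : ℝ) ^ ((1 : ℝ) / k) :=
      Real.rpow_le_rpow (by positivity) hcard (by positivity)
    have h2 : 8 * (k : ℝ) ^ 2 * (Fintype.card {x // x ∈ U} : ℝ) ^ ((1 : ℝ) / k) ≤
        8 * (k : ℝ) ^ 2 * (Fintype.card V : ℝ) ^ ((1 : ℝ) / k) := by gcongr
    linarith
  refine (core G' k m hk hm (d / 2) (by linarith) hdeg hlarge).trans ?_
  norm_cast
  refine Nat.card_le_card_of_injective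
    (fun f => ⟨fun i => (f.1 i).1, fun i j hij => f.2.1 (Subtype.ext hij), fun i => f.2.2 i⟩) ?_
  intro f g hfg
  refine Subtype.ext (funext fun i => Subtype.ext ?_)
  exact congrFun (congrArg Subtype.val hfg) i

end EvenCycles



/-- For every integer `k ≥ 2`, every graph `G` on `n` vertices with average
degree `d ≥ 2·10⁵·k³·n^{1/k}` contains at least `(1/2)·(2¹²·k)^{−k}·d^{2k}` copies of the cycle
of length `2k`, where a copy of `C_{2k}` is a subgraph of `G` isomorphic to the cycle on `2k`
vertices. -/
theorem supersaturation_even_cycles {V : Type*} [Fintype V] (k : ℕ) (hk : 2 ≤ k)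
    (G : SimpleGraph V) (d : ℝ)
    (hd : d = 2 * (Nat.card G.edgeSet : ℝ) / (Fintype.card V : ℝ))
    (hdlarge : 2 * 10 ^ 5 * (k : ℝ) ^ 3 * (Fintype.card V : ℝ) ^ ((1 : ℝ) / k) ≤ d) :
    (1 / 2 : ℝ) * ((2 ^ 12 * (k : ℝ)) ^ k)⁻¹ * d ^ (2 * k) ≤
      (Nat.card {H : G.Subgraph // Nonempty (H.coe ≃g SimpleGraph.cycleGraph (2 * k))} : ℝ) := by
  by_cases hd0 : d ≤ 0
  · have hge : 0 ≤ d := by rw [hd]; positivity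
    have hd00 : d = 0 := le_antisymm hd0 hge
    rw [hd00, zero_pow (by omega), mul_zero]
    positivity
  push Not at hd0
  have hk1 : (2 : ℝ) ≤ k := by exact_mod_cast hk
  have hlarge : 16 * (k : ℝ) ^ 2 * (Fintype.card V : ℝ) ^ ((1 : ℝ) / k) ≤ d := by
    refine le_trans ?_ hdlarge
    refine mul_le_mul_of_nonneg_right ?_ (by positivity)
    nlinarith [sq_nonneg (k : ℝ), mul_nonneg (sq_nonneg (k : ℝ)) (by linarith : (0 : ℝ) ≤ k - 2)]
  obtain ⟨m, hm⟩ : ∃ m, 2 * k = m + 2 := ⟨2 * k - 2, by omega⟩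
  have h1 := EvenCycles.tuples_lower k (m + 1) hk hm G d hd0 hd hlarge
  have h2 := EvenCycles.card_tuples_le (m := m) (by omega) G
  have h3 : (1 / 2 : ℝ) * (d / 2) ^ (2 * k) ≤ (2 * (k : ℝ)) ^ 2 *
      (Nat.card {H : G.Subgraph //
        Nonempty (H.coe ≃g SimpleGraph.cycleGraph (2 * k))} : ℝ) := by
    refine h1.trans ?_
    have h4 : (2 * (k : ℝ)) = ((m + 2 : ℕ) : ℝ) := by rw [← hm]; push_cast; ring
    rw [h4, hm]
    exact_mod_cast h2
  set Y : ℝ := (Nat.card {H : G.Subgraph //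
        Nonempty (H.coe ≃g SimpleGraph.cycleGraph (2 * k))} : ℝ) with hY
  have hY0 : 0 ≤ Y := Nat.cast_nonneg _
  have h5 : (2 * (k : ℝ)) ^ 2 * 4 ^ k ≤ (2 ^ 12 * (k : ℝ)) ^ k := by
    calc (2 * (k : ℝ)) ^ 2 * 4 ^ k ≤ (2 * (k : ℝ)) ^ k * 4 ^ k := by
          refine mul_le_mul_of_nonneg_right ?_ (by positivity)
          exact pow_le_pow_right₀ (by linarith) hk
      _ = (8 * (k : ℝ)) ^ k := by rw [← mul_pow]; ring
      _ ≤ _ := by gcongr; norm_num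
  have h6 : (d / 2) ^ (2 * k) * 4 ^ k = d ^ (2 * k) := by
    rw [div_pow, pow_mul 2 2 k]
    norm_num
  have hP : 0 < (2 ^ 12 * (k : ℝ)) ^ k := by positivity
  have h7 : (1 / 2 : ℝ) * d ^ (2 * k) ≤ (2 ^ 12 * (k : ℝ)) ^ k * Y := by
    calc (1 / 2 : ℝ) * d ^ (2 * k) = ((1 / 2 : ℝ) * (d / 2) ^ (2 * k)) * 4 ^ k := by
          rw [← h6]; ring
      _ ≤ ((2 * (k : ℝ)) ^ 2 * Y) * 4 ^ k := by gcongr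
      _ = ((2 * (k : ℝ)) ^ 2 * 4 ^ k) * Y := by ring
      _ ≤ _ := by gcongr
  calc (1 / 2 : ℝ) * ((2 ^ 12 * (k : ℝ)) ^ k)⁻¹ * d ^ (2 * k)
      = ((2 ^ 12 * (k : ℝ)) ^ k)⁻¹ * ((1 / 2 : ℝ) * d ^ (2 * k)) := by ring
    _ ≤ ((2 ^ 12 * (k : ℝ)) ^ k)⁻¹ * ((2 ^ 12 * (k : ℝ)) ^ k * Y) := by gcongr
    _ = Y := by rw [← mul_assoc, inv_mul_cancel₀ hP.ne', one_mul]
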